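/- (Parseval-type identities for the SQFT on L².) Let Ψ_s : L²(ℝ²,ℍ) → L²(ℝ²,ℍ) be continuous with respect to the L² norm and agree almost everywhere with ℱ_s on L¹(ℝ²,ℍ) ∩ L²(ℝ²,ℍ). Then for all f, g ∈ L²(ℝ²,ℍ), writing F := Ψ_s f and G := Ψ_s g: (a) ‖F‖₂ = ‖f‖₂; (b) Sc(⟨F, G⟩) = Sc(⟨f, g⟩); (c) Sc(i·⟨F, G⟩) = Sc(i·⟨f, g⟩); (d) if moreover both f and g are ℂ_i-valued (their j- and k-components vanish), or both are even with respect to the first variable, then ⟨F, G⟩ = ⟨f, g⟩. -/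

import Mathlib

open MeasureTheory Real ENNReal

noncomputable section

/-- The real quaternions. -/
abbrev Hq := Quaternion ℝ

/-- The imaginary unit `i`. -/
def qi : Hq := ⟨0,1,0,0⟩
/-- The imaginary unit `j`. -/
def qj : Hq := ⟨0,0,1,0⟩
/-- The imaginary unit `k`. -/
def qk : Hq := ⟨0,0,0,1⟩

/-- For a (unit pure imaginary) quaternion `u`, `e^{uθ} := cos θ + u sin θ`. -/
def qexp (u : Hq) (θ : ℝ) : Hq := (Real.cos θ) • (1 : Hq) + (Real.sin θ) • u

/-- The right-sided quaternion Fourier transform of `f ∈ L¹(ℝ²,ℍ)`. -/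
def Fr (f : ℝ × ℝ → Hq) (ω : ℝ × ℝ) : Hq :=
  (1 / (2 * Real.pi)) • ∫ x : ℝ × ℝ, f x * qexp qi (-(ω.1 * x.1)) * qexp qj (-(ω.2 * x.2))

/-- The two-sided quaternion Fourier transform of `f ∈ L¹(ℝ²,ℍ)`. -/
def Fs (f : ℝ × ℝ → Hq) (ω : ℝ × ℝ) : Hq :=
  (1 / (2 * Real.pi)) • ∫ x : ℝ × ℝ, qexp qi (-(ω.1 * x.1)) * f x * qexp qj (-(ω.2 * x.2))

open scoped SchwartzMap FourierTransform

lemma planch (h : 𝓢(ℝ × ℝ, ℂ)) : ∃ G : 𝓢(ℝ × ℝ, ℂ),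
    (∀ ω : ℝ × ℝ, G ω = (1 / (2 * Real.pi)) •
      ∫ x : ℝ × ℝ, Complex.exp ((-(ω.1 * x.1 + ω.2 * x.2) : ℝ) * Complex.I) * h x) ∧
    ∫ ω, ‖G ω‖ ^ 2 = ∫ x, ‖h x‖ ^ 2 := by
  let e := WithLp.prodContinuousLinearEquiv 2 ℝ ℝ ℝ
  let h' : 𝓢(WithLp 2 (ℝ × ℝ), ℂ) := SchwartzMap.compCLMOfContinuousLinearEquiv ℂ e h
  have hp : (0:ℝ) < 2 * Real.pi := by positivity
  let sc : (ℝ × ℝ) ≃L[ℝ] (ℝ × ℝ) :=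
    ContinuousLinearEquiv.smulLeft (Units.mk0 ((2 * Real.pi)⁻¹ : ℝ) (by positivity))
  let G : 𝓢(ℝ × ℝ, ℂ) := ((1 / (2 * Real.pi) : ℝ) : ℂ) •
    SchwartzMap.compCLMOfContinuousLinearEquiv ℂ (sc.trans e.symm) (𝓕 h')
  have hG : ∀ ω, G ω = ((1 / (2 * Real.pi) : ℝ) : ℂ) * 𝓕 h' (WithLp.toLp 2 ((2 * Real.pi)⁻¹ • ω)) :=
    fun ω => rfl
  refine ⟨G, ?_, ?_⟩
  · intro ω
    rw [hG, Complex.real_smul]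
    congr 1
    rw [SchwartzMap.fourier_coe, Real.fourier_eq', ← (WithLp.volume_preserving_toLp ℝ ℝ).integral_comp
      (MeasurableEquiv.toLp 2 (ℝ × ℝ)).measurableEmbedding]
    congr 1
    ext x
    have : h' (WithLp.toLp 2 x) = h x := rfl
    rw [this, smul_eq_mul]
    congr 3
    simp [WithLp.prod_inner_apply]
    field_simp
    ring
  · have h1 : ∫ x, ‖h x‖ ^ 2 = ∫ x, ‖𝓕 h' x‖ ^ 2 := by
      rw [SchwartzMap.integral_norm_sq_fourier, ← (WithLp.volume_preserving_toLp ℝ ℝ).integral_comp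
        (MeasurableEquiv.toLp 2 (ℝ × ℝ)).measurableEmbedding]
      rfl
    rw [h1, ← (WithLp.volume_preserving_toLp ℝ ℝ).integral_comp
        (MeasurableEquiv.toLp 2 (ℝ × ℝ)).measurableEmbedding]
    simp_rw [hG, norm_mul, mul_pow]
    rw [integral_const_mul, Measure.integral_comp_smul volume
      (fun y : ℝ × ℝ => ‖𝓕 h' (WithLp.toLp 2 y)‖ ^ 2) ((2 * Real.pi)⁻¹)]
    simp [-mul_inv_rev]
/-- The coordinates `c_s`. -/
def cLin (s : ℝ) : Hq →ₗ[ℝ] ℂ where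
  toFun q := ⟨q.re + s * q.imK, q.imI - s * q.imJ⟩
  map_add' p q := by apply Complex.ext <;> simp <;> ring
  map_smul' r q := by apply Complex.ext <;> simp <;> ring

def cL (s : ℝ) : Hq →L[ℝ] ℂ := LinearMap.toContinuousLinearMap (cLin s)

lemma cL_apply (s : ℝ) (q : Hq) : cL s q = ⟨q.re + s * q.imK, q.imI - s * q.imJ⟩ := rfl

lemma cL_norm (q : Hq) : ‖q‖ ^ 2 = (1/2) * (‖cL 1 q‖ ^ 2 + ‖cL (-1) q‖ ^ 2) := by
  rw [sq ‖q‖, ← Quaternion.normSq_eq_norm_mul_self, Quaternion.normSq_def', Complex.sq_norm, Complex.sq_norm,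
    cL_apply, cL_apply, Complex.normSq_mk, Complex.normSq_mk]
  ring

lemma qiexp_re (a : ℝ) : (qexp qi a).re = Real.cos a := by
  change Real.cos a * 1 + Real.sin a * 0 = Real.cos a; ring

lemma qiexp_imI (a : ℝ) : (qexp qi a).imI = Real.sin a := by
  change Real.cos a * 0 + Real.sin a * 1 = Real.sin a; ring

lemma qiexp_imJ (a : ℝ) : (qexp qi a).imJ = 0 := by
  change Real.cos a * 0 + Real.sin a * 0 = 0; ring

lemma qiexp_imK (a : ℝ) : (qexp qi a).imK = 0 := by
  change Real.cos a * 0 + Real.sin a * 0 = 0; ring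

lemma qjexp_re (a : ℝ) : (qexp qj a).re = Real.cos a := by
  change Real.cos a * 1 + Real.sin a * 0 = Real.cos a; ring

lemma qjexp_imI (a : ℝ) : (qexp qj a).imI = 0 := by
  change Real.cos a * 0 + Real.sin a * 0 = 0; ring

lemma qjexp_imJ (a : ℝ) : (qexp qj a).imJ = Real.sin a := by
  change Real.cos a * 0 + Real.sin a * 1 = Real.sin a; ring

lemma qjexp_imK (a : ℝ) : (qexp qj a).imK = 0 := by
  change Real.cos a * 0 + Real.sin a * 0 = 0; ring

lemma cL_exp (s : ℝ) (hs : s * s = 1) (a b : ℝ) (q : Hq) :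
    cL s (qexp qi a * q * qexp qj b) = Complex.exp ((a - s * b : ℝ) * Complex.I) * cL s q := by
  rw [cL_apply, cL_apply]
  rcases mul_self_eq_one_iff.1 hs with rfl | rfl
  all_goals
    apply Complex.ext
    all_goals
      simp only [Quaternion.re_mul, Quaternion.imI_mul, Quaternion.imJ_mul, Quaternion.imK_mul,
        Complex.mul_re, Complex.mul_im, Complex.exp_ofReal_mul_I_re, Complex.exp_ofReal_mul_I_im,
        Real.cos_sub, Real.sin_sub, neg_mul, one_mul, Real.cos_neg, Real.sin_neg,
        qiexp_re, qiexp_imI, qiexp_imJ, qiexp_imK, qjexp_re, qjexp_imI, qjexp_imJ, qjexp_imK]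
      ring

lemma qexp_norm_le (u : Hq) (hu : ‖u‖ = 1) (θ : ℝ) : ‖qexp u θ‖ ≤ 2 := by
  unfold qexp
  refine (norm_add_le _ _).trans ?_
  rw [norm_smul, norm_smul, hu, norm_one]
  have := Real.abs_cos_le_one θ
  have := Real.abs_sin_le_one θ
  simp only [Real.norm_eq_abs]
  linarith

lemma norm_qi : ‖qi‖ = 1 := by
  have : ‖qi‖ * ‖qi‖ = 1 := by
    rw [← Quaternion.normSq_eq_norm_mul_self, Quaternion.normSq_def']; simp [qi]
  nlinarith [norm_nonneg qi]

lemma norm_qj : ‖qj‖ = 1 := by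
  have : ‖qj‖ * ‖qj‖ = 1 := by
    rw [← Quaternion.normSq_eq_norm_mul_self, Quaternion.normSq_def']; simp [qj]
  nlinarith [norm_nonneg qj]

lemma qexp_cont (u : Hq) : Continuous (qexp u) := by
  unfold qexp; fun_prop

lemma integrable_kernel {f : ℝ × ℝ → Hq} (hf : Integrable f) (ω : ℝ × ℝ) :
    Integrable (fun x : ℝ × ℝ => qexp qi (-(ω.1 * x.1)) * f x * qexp qj (-(ω.2 * x.2))) := by
  have c1 : Continuous (fun x : ℝ × ℝ => qexp qi (-(ω.1 * x.1))) :=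
    (qexp_cont qi).comp (by fun_prop)
  have c2 : Continuous (fun x : ℝ × ℝ => qexp qj (-(ω.2 * x.2))) :=
    (qexp_cont qj).comp (by fun_prop)
  refine (hf.norm.const_mul 4).mono' ((c1.aestronglyMeasurable.mul hf.1).mul c2.aestronglyMeasurable) ?_
  filter_upwards with x
  rw [norm_mul, norm_mul]
  have h1 := qexp_norm_le qi norm_qi (-(ω.1 * x.1))
  have h2 := qexp_norm_le qj norm_qj (-(ω.2 * x.2))
  calc _ ≤ 2 * ‖f x‖ * 2 := by gcongr
    _ = _ := by ring

lemma cL_Fs (s : ℝ) (hs : s * s = 1) {f : ℝ × ℝ → Hq} (hf : Integrable f) (ω : ℝ × ℝ) :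
    cL s (Fs f ω) = (1 / (2 * Real.pi)) •
      ∫ x : ℝ × ℝ, Complex.exp ((-(ω.1 * x.1 + (-s * ω.2) * x.2) : ℝ) * Complex.I) * cL s (f x) := by
  unfold Fs
  rw [map_smul, ← ContinuousLinearMap.integral_comp_comm _ (integrable_kernel hf ω)]
  congr 2
  ext x
  rw [cL_exp s hs]
  congr 4
  ring

lemma cL_Fs_schwartz (s : ℝ) (hs : s * s = 1) (f : 𝓢(ℝ × ℝ, Hq)) :
    Integrable (fun ω => ‖cL s (Fs f ω)‖ ^ 2) ∧
    ∫ ω, ‖cL s (Fs f ω)‖ ^ 2 = ∫ x, ‖cL s (f x)‖ ^ 2 := by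
  obtain ⟨G, hG, hG2⟩ := planch (SchwartzMap.postcompCLM (cL s) f)
  have hG2' : ∫ ω, ‖G ω‖ ^ 2 = ∫ x, ‖cL s (f x)‖ ^ 2 := hG2
  have key : ∀ ω, cL s (Fs f ω) = G (ω.1, -s * ω.2) := by
    intro ω
    rw [cL_Fs s hs f.integrable, hG]
    rfl
  simp_rw [key]
  have hi : Integrable (fun ω => ‖G ω‖ ^ 2) :=
    (memLp_two_iff_integrable_sq_norm G.continuous.aestronglyMeasurable).1 (G.memLp 2)
  have mp : MeasurePreserving (fun ω : ℝ × ℝ => (ω.1, -s * ω.2)) := by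
    have h2 : MeasurePreserving (fun y : ℝ => -s * y) := by
      rcases mul_self_eq_one_iff.1 hs with rfl | rfl
      · simpa using Measure.measurePreserving_neg (volume : Measure ℝ)
      · have : (fun y : ℝ => -(-1) * y) = id := by ext y; simp
        rw [this]
        exact MeasurePreserving.id (volume : Measure ℝ)
    exact (MeasurePreserving.id (volume : Measure ℝ)).prod h2
  have me : MeasurableEmbedding (fun ω : ℝ × ℝ => (ω.1, -s * ω.2)) := by
    refine MeasurableEmbedding.of_measurable_inverse mp.measurable (g := fun ω => (ω.1, -s * ω.2)) ?_ mp.measurable ?_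
    · convert MeasurableSet.univ
      refine Set.eq_univ_of_forall fun y => ⟨(y.1, -s * y.2), ?_⟩
      ext <;> simp
      rw [← mul_assoc, hs, one_mul]
    · intro y
      ext <;> simp
      rw [← mul_assoc, hs, one_mul]
  exact ⟨(mp.integrable_comp_emb me).2 hi, (mp.integral_comp me (fun ω => ‖G ω‖ ^ 2)).trans hG2'⟩

lemma Fs_schwartz (f : 𝓢(ℝ × ℝ, Hq)) : ∫ ω, ‖Fs f ω‖ ^ 2 = ∫ x, ‖f x‖ ^ 2 := by
  obtain ⟨i1, e1⟩ := cL_Fs_schwartz 1 (by norm_num) f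
  obtain ⟨i2, e2⟩ := cL_Fs_schwartz (-1) (by norm_num) f
  have j (s : ℝ) : Integrable (fun ω => ‖cL s (f ω)‖ ^ 2) :=
    (memLp_two_iff_integrable_sq_norm
      (SchwartzMap.postcompCLM (cL s) f).continuous.aestronglyMeasurable).1
      ((SchwartzMap.postcompCLM (cL s) f).memLp 2)
  simp_rw [cL_norm]
  rw [integral_const_mul, integral_const_mul, integral_add i1 i2, integral_add (j 1) (j (-1)), e1, e2]

lemma qi_re : qi.re = 0 := rfl
lemma qi_imI : qi.imI = 1 := rfl
lemma qi_imJ : qi.imJ = 0 := rfl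
lemma qi_imK : qi.imK = 0 := rfl
lemma qj_re : qj.re = 0 := rfl
lemma qj_imI : qj.imI = 0 := rfl
lemma qj_imJ : qj.imJ = 1 := rfl
lemma qj_imK : qj.imK = 0 := rfl
lemma qk_re : qk.re = 0 := rfl
lemma qk_imI : qk.imI = 0 := rfl
lemma qk_imJ : qk.imJ = 0 := rfl
lemma qk_imK : qk.imK = 1 := rfl

abbrev E2 := Lp Hq 2 (volume : Measure (ℝ × ℝ))

lemma dense_schwartz : DenseRange (SchwartzMap.toLpCLM ℝ (E := ℝ × ℝ) Hq 2 volume) :=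
  SchwartzMap.denseRange_toLpCLM (by norm_num)

lemma Fs_congr {f g : ℝ × ℝ → Hq} (h : f =ᵐ[volume] g) : Fs f = Fs g := by
  ext1 ω
  unfold Fs
  congr 1
  apply integral_congr_ae
  filter_upwards [h] with x hx
  rw [hx]

/-- left multiplication on `L²`. -/
def mL (q : Hq) : E2 →L[ℝ] E2 := (ContinuousLinearMap.mul ℝ Hq q).compLpL 2 volume

lemma mL_coe (q : Hq) (f : E2) : (mL q f : ℝ × ℝ → Hq) =ᵐ[volume] fun x => q * f x :=
  ContinuousLinearMap.coeFn_compLpL _ _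

lemma refl_mp : MeasurePreserving (fun x : ℝ × ℝ => (-x.1, x.2)) volume volume :=
  (Measure.measurePreserving_neg (volume : Measure ℝ)).prod (MeasurePreserving.id (volume : Measure ℝ))

lemma refl_me : MeasurableEmbedding (fun x : ℝ × ℝ => (-x.1, x.2)) :=
  ((MeasurableEquiv.neg ℝ).prodCongr (MeasurableEquiv.refl ℝ)).measurableEmbedding

/-- reflection on `L²`. -/
def RL : E2 →ₗᵢ[ℝ] E2 := Lp.compMeasurePreservingₗᵢ ℝ (fun x : ℝ × ℝ => (-x.1, x.2)) refl_mp

lemma RL_coe (f : E2) : (RL f : ℝ × ℝ → Hq) =ᵐ[volume] fun x => f (-x.1, x.2) :=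
  Lp.coeFn_compMeasurePreserving f refl_mp

lemma int_prod (f g : E2) : Integrable (fun x => f x * star (g x)) := by
  have hf := (memLp_two_iff_integrable_sq_norm (Lp.aestronglyMeasurable f)).1 (Lp.memLp f)
  have hg := (memLp_two_iff_integrable_sq_norm (Lp.aestronglyMeasurable g)).1 (Lp.memLp g)
  refine (hf.add hg).mono' ((Lp.aestronglyMeasurable f).mul
    (continuous_star.comp_aestronglyMeasurable (Lp.aestronglyMeasurable g))) ?_
  filter_upwards with x
  rw [norm_mul, norm_star]
  simp only [Pi.add_apply]
  nlinarith [sq_nonneg (‖f x‖ - ‖g x‖), sq_nonneg (‖f x‖), sq_nonneg (‖g x‖)]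

/-- the real part, as a continuous linear map. -/
def reL : Hq →L[ℝ] ℝ := LinearMap.toContinuousLinearMap
  { toFun := fun q : Hq => q.re, map_add' := fun _ _ => rfl, map_smul' := fun _ _ => rfl }

lemma re_mul_int (q : Hq) (f g : E2) :
    (q * ∫ x, f x * star (g x)).re = inner ℝ (mL q f) g := by
  have h1 := (reL.comp (ContinuousLinearMap.mul ℝ Hq q)).integral_comp_comm (int_prod f g)
  have h2 : (q * ∫ x, f x * star (g x)).re =
    (reL.comp (ContinuousLinearMap.mul ℝ Hq q)) (∫ x, f x * star (g x)) := rfl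
  rw [h2, ← h1, L2.inner_def]
  apply integral_congr_ae
  filter_upwards [mL_coe q f] with x hx
  rw [hx, Quaternion.inner_def, mul_assoc]
  rfl

lemma re_int (f g : E2) : (∫ x, f x * star (g x)).re = inner ℝ f g := by
  have h := re_mul_int 1 f g
  rw [one_mul] at h
  rw [h]
  congr 1
  apply Lp.ext
  filter_upwards [mL_coe 1 f] with x hx
  rw [hx, one_mul]

lemma norm_sq_L2 (f : E2) : ‖f‖ ^ 2 = ∫ x, ‖f x‖ ^ 2 := by
  rw [← real_inner_self_eq_norm_sq, L2.inner_def]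
  simp_rw [real_inner_self_eq_norm_sq]

lemma Fs_add {f g : ℝ × ℝ → Hq} (hf : Integrable f) (hg : Integrable g) :
    Fs (f + g) = Fs f + Fs g := by
  ext1 ω
  simp only [Fs, Pi.add_apply]
  rw [← smul_add, ← integral_add (integrable_kernel hf ω) (integrable_kernel hg ω)]
  congr 2
  ext1 x
  noncomm_ring

lemma qi_comm (a : ℝ) : qexp qi a * qi = qi * qexp qi a := by
  unfold qexp
  simp [mul_add, add_mul]

lemma qj_comm (a : ℝ) : qexp qi a * qj = qj * qexp qi (-a) := by
  have : qi * qj = - (qj * qi) := by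
    apply Quaternion.ext <;> simp [Quaternion.re_mul, Quaternion.imI_mul, Quaternion.imJ_mul, Quaternion.imK_mul,
      qi_re, qi_imI, qi_imJ, qi_imK, qj_re, qj_imI, qj_imJ, qj_imK, qk_re, qk_imI, qk_imJ, qk_imK]
  unfold qexp
  simp [mul_add, add_mul, this]

lemma Fs_qi {f : ℝ × ℝ → Hq} (hf : Integrable f) (ω : ℝ × ℝ) :
    Fs (fun x => qi * f x) ω = qi * Fs f ω := by
  unfold Fs
  have h1 := (ContinuousLinearMap.mul ℝ Hq qi).integral_comp_comm (integrable_kernel hf ω)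
  simp only [ContinuousLinearMap.mul_apply'] at h1
  rw [mul_smul_comm, ← h1]
  congr 2
  ext1 x
  rw [← mul_assoc, qi_comm]
  simp only [mul_assoc]

lemma Fs_qj {f : ℝ × ℝ → Hq} (hf : Integrable f) (ω : ℝ × ℝ) :
    Fs (fun x => qj * f (-x.1, x.2)) ω = qj * Fs f ω := by
  unfold Fs
  have h1 := (ContinuousLinearMap.mul ℝ Hq qj).integral_comp_comm (integrable_kernel hf ω)
  simp only [ContinuousLinearMap.mul_apply'] at h1
  rw [mul_smul_comm, ← h1, ← refl_mp.integral_comp refl_me]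
  congr 2
  ext1 x
  rw [← mul_assoc, qj_comm]
  simp only [mul_assoc, mul_neg, neg_neg]

lemma int_schwartz (f : 𝓢(ℝ × ℝ, Hq)) :
    Integrable (SchwartzMap.toLpCLM ℝ Hq 2 volume f : ℝ × ℝ → Hq) := 
  (integrable_congr (SchwartzMap.coeFn_toLp f 2 volume)).2 f.integrable

lemma psi_norm (Ψ : E2 → E2) (hcont : Continuous Ψ)
    (hagree : ∀ f : E2, Integrable (f : ℝ × ℝ → Hq) → (Ψ f : ℝ × ℝ → Hq) =ᵐ[volume] Fs f)
    (f : E2) : ‖Ψ f‖ = ‖f‖ := by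
  refine dense_schwartz.induction_on f (isClosed_eq (by fun_prop) (by fun_prop)) ?_
  intro h
  have h1 := hagree _ (int_schwartz h)
  have h2 := SchwartzMap.coeFn_toLp h 2 (volume : Measure (ℝ × ℝ))
  have h2' : (SchwartzMap.toLpCLM ℝ Hq 2 volume h : ℝ × ℝ → Hq) =ᵐ[volume] h := h2
  rw [← sq_eq_sq₀ (norm_nonneg _) (norm_nonneg _), norm_sq_L2, norm_sq_L2]
  rw [Fs_congr h2'] at h1
  calc _ = ∫ ω, ‖Fs h ω‖ ^ 2 := integral_congr_ae (by filter_upwards [h1] with x hx; rw [hx])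
    _ = ∫ x, ‖h x‖ ^ 2 := Fs_schwartz h
    _ = _ := integral_congr_ae (by filter_upwards [h2'] with x hx; rw [hx])

lemma psi_add (Ψ : E2 → E2) (hcont : Continuous Ψ)
    (hagree : ∀ f : E2, Integrable (f : ℝ × ℝ → Hq) → (Ψ f : ℝ × ℝ → Hq) =ᵐ[volume] Fs f)
    (f g : E2) : Ψ (f + g) = Ψ f + Ψ g := by
  refine dense_schwartz.induction_on₂ (p := fun f g => Ψ (f + g) = Ψ f + Ψ g)
    (isClosed_eq (by fun_prop) (by fun_prop)) ?_ f g
  intro a b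
  have ha := int_schwartz a
  have hb := int_schwartz b
  generalize SchwartzMap.toLpCLM ℝ Hq 2 volume a = u at ha
  generalize SchwartzMap.toLpCLM ℝ Hq 2 volume b = v at hb
  have hs := Lp.coeFn_add u v
  have h3 := hagree (u + v) ((integrable_congr hs).2 (ha.add hb))
  rw [Fs_congr hs, Fs_add ha hb] at h3
  apply Lp.ext
  filter_upwards [h3, hagree u ha, hagree v hb, Lp.coeFn_add (Ψ u) (Ψ v)] with x h1 h2 h3 h4
  rw [h1, h4, Pi.add_apply, Pi.add_apply, h2, h3]

lemma psi_inner (Ψ : E2 → E2) (hcont : Continuous Ψ)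
    (hagree : ∀ f : E2, Integrable (f : ℝ × ℝ → Hq) → (Ψ f : ℝ × ℝ → Hq) =ᵐ[volume] Fs f)
    (f g : E2) : inner ℝ (Ψ f) (Ψ g) = inner ℝ f g := by
  have h1 := psi_norm Ψ hcont hagree (f + g)
  have h2 := psi_norm Ψ hcont hagree f
  have h3 := psi_norm Ψ hcont hagree g
  have e1 := norm_add_sq_real f g
  have e2 := norm_add_sq_real (Ψ f) (Ψ g)
  rw [← psi_add Ψ hcont hagree, h1, h2, h3] at e2
  linarith

lemma psi_qi (Ψ : E2 → E2) (hcont : Continuous Ψ)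
    (hagree : ∀ f : E2, Integrable (f : ℝ × ℝ → Hq) → (Ψ f : ℝ × ℝ → Hq) =ᵐ[volume] Fs f)
    (f : E2) : Ψ (mL qi f) = mL qi (Ψ f) := by
  refine dense_schwartz.induction_on f (isClosed_eq (by fun_prop) (by fun_prop)) ?_
  intro a
  have ha := int_schwartz a
  generalize SchwartzMap.toLpCLM ℝ Hq 2 volume a = u at ha
  have hs := mL_coe qi u
  have h3 := hagree (mL qi u) ((integrable_congr hs).2 (ha.const_mul qi))
  rw [Fs_congr hs] at h3
  apply Lp.ext
  filter_upwards [h3, hagree u ha, mL_coe qi (Ψ u)] with x h1 h2 h3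
  rw [h1, h3, Fs_qi ha, h2]

lemma psi_qj (Ψ : E2 → E2) (hcont : Continuous Ψ)
    (hagree : ∀ f : E2, Integrable (f : ℝ × ℝ → Hq) → (Ψ f : ℝ × ℝ → Hq) =ᵐ[volume] Fs f)
    (f : E2) : Ψ (mL qj (RL f)) = mL qj (Ψ f) := by
  refine dense_schwartz.induction_on f (isClosed_eq ?_ (by fun_prop)) ?_
  · exact hcont.comp ((mL qj).continuous.comp RL.continuous)
  intro a
  have ha := int_schwartz a
  generalize SchwartzMap.toLpCLM ℝ Hq 2 volume a = u at ha
  have hs : (mL qj (RL u) : ℝ × ℝ → Hq) =ᵐ[volume] fun x => qj * u (-x.1, x.2) := by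
    filter_upwards [mL_coe qj (RL u), RL_coe u] with x h1 h2
    rw [h1, h2]
  have h3 := hagree (mL qj (RL u)) ((integrable_congr hs).2
    (((refl_mp.integrable_comp_emb refl_me).2 ha).const_mul qj))
  rw [Fs_congr hs] at h3
  apply Lp.ext
  filter_upwards [h3, hagree u ha, mL_coe qj (Ψ u)] with x h1 h2 h3
  rw [h1, h3, Fs_qj ha, h2]

lemma mL_qk (f : E2) : mL qk f = mL qi (mL qj f) := by
  apply Lp.ext
  filter_upwards [mL_coe qk f, mL_coe qj f, mL_coe qi (mL qj f)] with x h1 h2 h3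
  rw [h1, h3, h2, ← mul_assoc]
  congr 1
  apply Quaternion.ext <;> simp [Quaternion.re_mul, Quaternion.imI_mul, Quaternion.imJ_mul, Quaternion.imK_mul,
      qi_re, qi_imI, qi_imJ, qi_imK, qj_re, qj_imI, qj_imJ, qj_imK, qk_re, qk_imI, qk_imJ, qk_imK]

lemma inner_zero (q : Hq) (hq : q.re = 0 ∧ q.imI = 0) (f g : E2)
    (hf : ∀ᵐ x : ℝ × ℝ, (f x).imJ = 0 ∧ (f x).imK = 0)
    (hg : ∀ᵐ x : ℝ × ℝ, (g x).imJ = 0 ∧ (g x).imK = 0) : inner ℝ (mL q f) g = 0 := by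
  rw [L2.inner_def]
  apply integral_eq_zero_of_ae
  filter_upwards [mL_coe q f, hf, hg] with x h1 h2 h3
  rw [h1, Quaternion.inner_def]
  simp [Quaternion.re_mul, Quaternion.imI_mul, Quaternion.imJ_mul, Quaternion.imK_mul, hq, h2, h3]

lemma ext_of_re {z w : Hq} (h0 : z.re = w.re) (h1 : (qi * z).re = (qi * w).re)
    (h2 : (qj * z).re = (qj * w).re) (h3 : (qk * z).re = (qk * w).re) : z = w := by
  rw [Quaternion.re_mul, Quaternion.re_mul] at h1 h2 h3
  apply Quaternion.ext
  · exact h0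
  · simpa [qi] using h1
  · simpa [qj] using h2
  · simpa [qk] using h3

theorem stmt12 (Ψ : Lp Hq 2 (volume : Measure (ℝ × ℝ)) → Lp Hq 2 (volume : Measure (ℝ × ℝ)))
    (hcont : Continuous Ψ)
    (hagree : ∀ f : Lp Hq 2 (volume : Measure (ℝ × ℝ)),
      Integrable (f : ℝ × ℝ → Hq) → (Ψ f : ℝ × ℝ → Hq) =ᵐ[volume] Fs f)
    (f g : Lp Hq 2 (volume : Measure (ℝ × ℝ))) :
    ‖Ψ f‖ = ‖f‖ ∧
    (∫ ω : ℝ × ℝ, (Ψ f) ω * star ((Ψ g) ω)).re = (∫ x : ℝ × ℝ, f x * star (g x)).re ∧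
    (qi * ∫ ω : ℝ × ℝ, (Ψ f) ω * star ((Ψ g) ω)).re =
      (qi * ∫ x : ℝ × ℝ, f x * star (g x)).re ∧
    ((((∀ᵐ x : ℝ × ℝ, (f x).imJ = 0 ∧ (f x).imK = 0) ∧
        (∀ᵐ x : ℝ × ℝ, (g x).imJ = 0 ∧ (g x).imK = 0)) ∨
      ((∀ᵐ x : ℝ × ℝ, f (-x.1, x.2) = f x) ∧ (∀ᵐ x : ℝ × ℝ, g (-x.1, x.2) = g x))) →
      (∫ ω : ℝ × ℝ, (Ψ f) ω * star ((Ψ g) ω)) = ∫ x : ℝ × ℝ, f x * star (g x)) := by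
  have hb : ∀ u v : E2, inner ℝ (Ψ u) (Ψ v) = inner ℝ u v := psi_inner Ψ hcont hagree
  have hi : ∀ u : E2, Ψ (mL qi u) = mL qi (Ψ u) := psi_qi Ψ hcont hagree
  have hj : ∀ u : E2, Ψ (mL qj (RL u)) = mL qj (Ψ u) := psi_qj Ψ hcont hagree
  have pb : (∫ ω : ℝ × ℝ, (Ψ f) ω * star ((Ψ g) ω)).re = (∫ x : ℝ × ℝ, f x * star (g x)).re := by
    rw [re_int, re_int, hb]
  have pc : (qi * ∫ ω : ℝ × ℝ, (Ψ f) ω * star ((Ψ g) ω)).re =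
      (qi * ∫ x : ℝ × ℝ, f x * star (g x)).re := by
    rw [re_mul_int, re_mul_int, ← hi, hb]
  refine ⟨psi_norm Ψ hcont hagree f, pb, pc, fun h => ext_of_re pb pc ?_ ?_⟩
  · rw [re_mul_int, re_mul_int, ← hj, hb]
    rcases h with ⟨hf, hg⟩ | ⟨hf, hg⟩
    · have hR : ∀ᵐ x : ℝ × ℝ, (RL f x).imJ = 0 ∧ (RL f x).imK = 0 := by
        filter_upwards [RL_coe f, refl_mp.quasiMeasurePreserving.ae hf] with x h1 h2
        rw [h1]; exact h2
      rw [inner_zero qj ⟨rfl, rfl⟩ _ _ hR hg, inner_zero qj ⟨rfl, rfl⟩ _ _ hf hg]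
    · have : RL f = f := by
        apply Lp.ext
        filter_upwards [RL_coe f, hf] with x h1 h2
        rw [h1, h2]
      rw [this]
  · rw [re_mul_int, re_mul_int, mL_qk (Ψ f), ← hj, ← hi, hb, ← mL_qk]
    rcases h with ⟨hf, hg⟩ | ⟨hf, hg⟩
    · have hR : ∀ᵐ x : ℝ × ℝ, (RL f x).imJ = 0 ∧ (RL f x).imK = 0 := by
        filter_upwards [RL_coe f, refl_mp.quasiMeasurePreserving.ae hf] with x h1 h2
        rw [h1]; exact h2
      rw [inner_zero qk ⟨rfl, rfl⟩ _ _ hR hg, inner_zero qk ⟨rfl, rfl⟩ _ _ hf hg]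
    · have : RL f = f := by
        apply Lp.ext
        filter_upwards [RL_coe f, hf] with x h1 h2
        rw [h1, h2]
      rw [this]
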